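/- Let n ≥ 3, let ω = Σ_i λ_i F̂_i dF_i be a logarithmic 1-form of type 𝐝 with λ_i pairwise distinct and nonzero, Σ_i d_i λ_i = 0, and F_i in general position. Let α be a projective homogeneous polynomial 1-form of degree d with ω ∧ dα + α ∧ dω = 0. Then for each ordered pair (i, j), i ≠ j, there exist homogeneous polynomials A_{ij} of degree d_j such that at every nonzero point x of the cone {F_i = F_j = 0}, α(x) = F̂_{ij}(x)·(A_{ij}(x)·dF_i(x) + A_{ji}(x)·dF_j(x)). Moreover, the A's can be chosen so that for each fixed j there exists a single homogeneous polynomial F'_j of degree d_j with A_{ij} = λ_i·F'_j on the cone {F_i = F_j = 0}, for all i ≠ j. -/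

import Mathlib

open MvPolynomial Finset

namespace LogStab

/-- The polynomial ring `ℂ[x₀, …, x_{N-1}]`. -/
abbrev S (N : ℕ) : Type := MvPolynomial (Fin N) ℂ

/-- A polynomial 1-form `∑ₖ aₖ dxₖ` on `ℂ^N`, given by its coefficients `aₖ`. -/
abbrev Form1 (N : ℕ) : Type := Fin N → S N

/-- The differential `dF` of a polynomial, as a 1-form. -/
noncomputable def Dp {N : ℕ} (F : S N) : Form1 N := fun k => pderiv k F

/-- Exterior derivative of a 1-form: the antisymmetric coefficients of the 2-form `dω`,
`(dω)_{kl} = ∂ₖ ω_l - ∂_l ω_k`. -/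
noncomputable def extD {N : ℕ} (ω : Form1 N) : Fin N → Fin N → S N :=
  fun k l => pderiv k (ω l) - pderiv l (ω k)

/-- Wedge of two 1-forms: `(α ∧ β)_{kl} = αₖ β_l - α_l βₖ`. -/
noncomputable def w11 {N : ℕ} (α β : Form1 N) : Fin N → Fin N → S N :=
  fun k l => α k * β l - α l * β k

/-- Wedge of a 1-form and an (antisymmetric) 2-form: coefficients of the 3-form. -/
noncomputable def w12 {N : ℕ} (α : Form1 N) (β : Fin N → Fin N → S N) :
    Fin N → Fin N → Fin N → S N :=
  fun i j k => α i * β j k - α j * β i k + α k * β i j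

/-- Wedge of two (antisymmetric) 2-forms: coefficients of the 4-form. -/
noncomputable def w22 {N : ℕ} (β γ : Fin N → Fin N → S N) :
    Fin N → Fin N → Fin N → Fin N → S N :=
  fun i j k l =>
    β i j * γ k l - β i k * γ j l + β i l * γ j k + β j k * γ i l - β j l * γ i k + β k l * γ i j

/-- Contraction `⟨R, α⟩ = ∑ₖ xₖ aₖ` of a 1-form with the radial (Euler) vector field. -/
noncomputable def radial {N : ℕ} (α : Form1 N) : S N := ∑ k, X k * α k

/-- `α` is a homogeneous 1-form of degree `d`:
all its coefficients are homogeneous polynomials of degree `d - 1`. -/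
def IsHomog1 {N : ℕ} (α : Form1 N) (d : ℕ) : Prop := ∀ k, (α k).IsHomogeneous (d - 1)

/-- `F̂ᵢ = ∏_{j ≠ i} F_j`. -/
noncomputable def Fhat {N m : ℕ} (F : Fin m → S N) (i : Fin m) : S N :=
  ∏ j ∈ Finset.univ.erase i, F j

/-- `F̂ᵢⱼ = ∏_{k ≠ i, j} F_k`. -/
noncomputable def Fhat2 {N m : ℕ} (F : Fin m → S N) (i j : Fin m) : S N :=
  ∏ k ∈ (Finset.univ.erase i).erase j, F k

/-- The logarithmic 1-form `ω = μ(λ, F) = ∑ᵢ λᵢ F̂ᵢ dFᵢ`. -/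
noncomputable def logForm {N m : ℕ} (lam : Fin m → ℂ) (F : Fin m → S N) : Form1 N :=
  fun k => ∑ i, C (lam i) * Fhat F i * pderiv k (F i)

/-- The condition `ω ∧ dα + α ∧ dω = 0` (as a 3-form). -/
def TangentZero {N : ℕ} (ω α : Form1 N) : Prop :=
  ∀ i j k, w12 ω (extD α) i j k + w12 α (extD ω) i j k = 0

/-- The derivative of the multilinear map `μ` at `(λ, F)` in the direction `(λ', F')`:
`∑ᵢ λ'ᵢ F̂ᵢ dFᵢ + ∑_{i ≠ k} λᵢ F'ₖ F̂ᵢₖ dFᵢ + ∑ᵢ λᵢ F̂ᵢ dF'ᵢ`. -/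
noncomputable def dmu {N m : ℕ} (lam : Fin m → ℂ) (F : Fin m → S N)
    (lam' : Fin m → ℂ) (F' : Fin m → S N) : Form1 N :=
  fun k =>
    (∑ i, C (lam' i) * Fhat F i * pderiv k (F i)) +
    (∑ i, ∑ j ∈ Finset.univ.erase i, C (lam i) * F' j * Fhat2 F i j * pderiv k (F i)) +
    (∑ i, C (lam i) * Fhat F i * pderiv k (F' i))

/-- The `Fᵢ` are in general position: each `Fᵢ` is irreducible and at every nonzero point
of the cone the differentials of the `Fᵢ` vanishing there are linearly independent
(simple normal crossings; in particular each hypersurface is smooth). -/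
def GeneralPosition {N m : ℕ} (F : Fin m → S N) : Prop :=
  (∀ i, Irreducible (F i)) ∧
  ∀ x : Fin N → ℂ, x ≠ 0 →
    LinearIndependent ℂ (fun i : {i : Fin m // eval x (F i) = 0} =>
      (fun k => eval x (pderiv k (F i.1)) : Fin N → ℂ))

/-- A polynomial function on a complex vector space: an element of the subalgebra of
functions generated by the linear functionals. -/
def IsPolyFun {E : Type*} [AddCommGroup E] [Module ℂ E] (f : E → ℂ) : Prop :=
  f ∈ Algebra.adjoin ℂ {g : E → ℂ | IsLinearMap ℂ g}

/-- The Zariski topology on a complex vector space, generated by the basic open sets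
`{x | f x ≠ 0}` for `f` a polynomial function; closed sets are the common zero loci
of families of polynomial functions. -/
def zariskiTop (E : Type*) [AddCommGroup E] [Module ℂ E] : TopologicalSpace E :=
  TopologicalSpace.generateFrom {U | ∃ f : E → ℂ, IsPolyFun f ∧ U = {x | f x ≠ 0}}

section Depth

open CategoryTheory Abelian RingTheory.Sequence Pointwise

variable {R : Type} [CommRing R]

/-- `f` is a nonzerodivisor modulo `I`. -/
def NZD (I : Ideal R) (f : R) : Prop := ∀ u, f * u ∈ I → u ∈ I

/-- `Ext`-vanishing form of `depth_𝔪 (R ⧸ I) ≥ k`. -/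
def DepthGE (𝔪 I : Ideal R) (k : ℕ) : Prop :=
  ∀ N : ModuleCat.{0} R, Module.Finite R N → 𝔪 ≤ (Module.annihilator R N).radical →
    ∀ i < k, Subsingleton (Ext N (ModuleCat.of R (R ⧸ I)) i)

lemma NZD.isSMulRegular {I : Ideal R} {f : R} (h : NZD I f) : IsSMulRegular (R ⧸ I) f := by
  rw [isSMulRegular_iff_right_eq_zero_of_smul]
  intro x
  obtain ⟨u, rfl⟩ := Ideal.Quotient.mk_surjective x
  intro hx
  rw [Ideal.Quotient.eq_zero_iff_mem]
  apply h
  rw [← Ideal.Quotient.eq_zero_iff_mem, map_mul]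
  exact hx

/-- `(R ⧸ I) / f (R ⧸ I) ≃ R ⧸ (I + (f))`. -/
noncomputable def quotSMulTopEquiv (I : Ideal R) (f : R) :
    QuotSMulTop f (R ⧸ I) ≃ₗ[R] (R ⧸ (I ⊔ Ideal.span {f})) := by
  refine (Submodule.quotEquivOfEq _ (Submodule.map I.mkQ (I ⊔ Ideal.span {f})) ?_).trans
    (Submodule.quotientQuotientEquivQuotient I (I ⊔ Ideal.span {f}) le_sup_left)
  ext x
  obtain ⟨u, rfl⟩ := Submodule.mkQ_surjective I x
  rw [Submodule.mem_smul_pointwise_iff_exists, Submodule.mem_map]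
  constructor
  · rintro ⟨b, -, hb⟩
    obtain ⟨v, rfl⟩ := Submodule.mkQ_surjective I b
    exact ⟨f * v, Ideal.mem_sup_right (Ideal.mul_mem_right _ _ (Ideal.mem_span_singleton_self f)),
      hb⟩
  · rintro ⟨y, hy, hyu⟩
    obtain ⟨a, ha, b, hb, rfl⟩ := Submodule.mem_sup.1 hy
    obtain ⟨c, rfl⟩ := Ideal.mem_span_singleton'.1 hb
    refine ⟨I.mkQ c, trivial, ?_⟩
    rw [← hyu, map_add, ← map_smul, smul_eq_mul, mul_comm]
    have : I.mkQ a = 0 := (Submodule.Quotient.mk_eq_zero I).2 ha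
    rw [this, zero_add]

lemma DepthGE.sup_span {𝔪 I : Ideal R} {k : ℕ} (h : DepthGE 𝔪 I (k + 1)) {f : R}
    (hf : NZD I f) : DepthGE 𝔪 (I ⊔ Ideal.span {f}) k := by
  intro N hN hm i hi
  have zero1 := AddCommGrpCat.isZero_of_iff_subsingleton.mpr (h N hN hm i (by omega))
  have zero2 := AddCommGrpCat.isZero_of_iff_subsingleton.mpr (h N hN hm (i + 1) (by omega))
  have key : Subsingleton (Ext N (ModuleCat.of R (QuotSMulTop f (R ⧸ I))) i) :=
    AddCommGrpCat.subsingleton_of_isZero <| ShortComplex.Exact.isZero_of_both_zeros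
      ((Ext.covariant_sequence_exact₃' N
        (IsSMulRegular.smulShortComplex_shortExact (M := ModuleCat.of R (R ⧸ I))
          hf.isSMulRegular)) i (i + 1) rfl)
      (zero1.eq_zero_of_src _) (zero2.eq_zero_of_tgt _)
  have e := ((extFunctorObj N i).mapIso (quotSMulTopEquiv I f).toModuleIso)
  exact AddCommGrpCat.subsingleton_of_isZero
    ((AddCommGrpCat.isZero_of_iff_subsingleton.mpr key).of_iso e.symm)

lemma DepthGE.subsingleton_hom {𝔪 I J : Ideal R} [IsNoetherianRing R] {k : ℕ}
    (h : DepthGE 𝔪 I (k + 1))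
    (hJ : 𝔪 ≤ J.radical) : Subsingleton ((R ⧸ J) →ₗ[R] (R ⧸ I)) := by
  have h0 := h (ModuleCat.of R (R ⧸ J)) inferInstance
    (by change 𝔪 ≤ (Module.annihilator R (R ⧸ J)).radical
        rwa [Ideal.annihilator_quotient]) 0 (by omega)
  have : Subsingleton (ModuleCat.of R (R ⧸ J) ⟶ ModuleCat.of R (R ⧸ I)) :=
    Ext.addEquiv₀.subsingleton_congr.mp h0
  exact (ModuleCat.homAddEquiv (M := ModuleCat.of R (R ⧸ J))
    (N := ModuleCat.of R (R ⧸ I))).symm.subsingleton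

lemma DepthGE.mem_of_forall_mul_mem {𝔪 I J : Ideal R} [IsNoetherianRing R] {k : ℕ}
    (h : DepthGE 𝔪 I (k + 1))
    (hJ : 𝔪 ≤ J.radical) {u : R} (hu : ∀ j ∈ J, j * u ∈ I) : u ∈ I := by
  have := h.subsingleton_hom hJ
  let φ : (R ⧸ J) →ₗ[R] (R ⧸ I) := Submodule.liftQ J (LinearMap.toSpanSingleton R _ (I.mkQ u)) (by
    intro j hj
    rw [LinearMap.mem_ker, LinearMap.toSpanSingleton_apply, ← map_smul, smul_eq_mul]
    exact (Submodule.Quotient.mk_eq_zero I).2 (hu j hj))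
  have h1 : φ (J.mkQ 1) = 0 := by rw [Subsingleton.elim φ 0]; rfl
  have h2 : φ (J.mkQ 1) = I.mkQ u := (Submodule.liftQ_apply J _ (1 : R)).trans (one_smul R _)
  rw [h2] at h1
  exact (Submodule.Quotient.mk_eq_zero I).1 h1

lemma DepthGE.exists_nzd {𝔪 I J : Ideal R} [IsNoetherianRing R] {k : ℕ}
    (h : DepthGE 𝔪 I (k + 1))
    (hJ : 𝔪 ≤ J.radical) : ∃ f ∈ J, NZD I f := by
  have := h.subsingleton_hom hJ
  obtain ⟨x, hx, hreg⟩ := IsSMulRegular.subsingleton_linearMap_iff.mp this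
  rw [Ideal.annihilator_quotient] at hx
  refine ⟨x, hx, fun u hu => ?_⟩
  rw [isSMulRegular_iff_right_eq_zero_of_smul] at hreg
  have := hreg (Ideal.Quotient.mk I u) (by
    rw [← Ideal.Quotient.eq_zero_iff_mem, map_mul] at hu
    exact hu)
  rwa [Ideal.Quotient.eq_zero_iff_mem] at this

lemma NZD.mul {I : Ideal R} {f g : R} (hf : NZD I f) (hg : NZD I g) : NZD I (f * g) :=
  fun u hu => hg _ (hf _ (by rwa [mul_assoc] at hu))

lemma NZD.prod {ι : Type*} {I : Ideal R} {f : ι → R} {s : Finset ι} (h : ∀ i ∈ s, NZD I (f i)) :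
    NZD I (∏ i ∈ s, f i) := by
  classical
  induction s using Finset.induction_on with
  | empty => intro u hu; simpa using hu
  | insert a s ha ih =>
    rw [Finset.prod_insert ha]
    exact (h a (by simp)).mul (ih fun i hi => h i (by simp [hi]))

end Depth

section Vars

open CategoryTheory Abelian RingTheory.Sequence Pointwise

variable {N : ℕ}

/-- The ideal of the origin. -/
noncomputable def varIdeal (N : ℕ) : Ideal (MvPolynomial (Fin N) ℂ) := Ideal.span (X '' Set.univ)

lemma X_nzd (s : Set (Fin N)) (k : Fin N) (hk : k ∉ s) :
    NZD (Ideal.span (X '' s : Set (MvPolynomial (Fin N) ℂ))) (X k) := by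
  intro u hu
  rw [mem_ideal_span_X_image] at hu ⊢
  intro d hd
  obtain ⟨i, hi, hne⟩ := hu (Finsupp.single k 1 + d) (by
    rw [mem_support_iff, coeff_X_mul]; exact mem_support_iff.1 hd)
  refine ⟨i, hi, ?_⟩
  have hik : k ≠ i := by rintro rfl; exact hk hi
  simpa [Finsupp.single_apply, hik] using hne

lemma isRegular_X [NeZero N] : IsRegular (MvPolynomial (Fin N) ℂ)
    ((List.finRange N).map (X : Fin N → MvPolynomial (Fin N) ℂ)) := by
  constructor
  · constructor
    intro i hi
    have hi' : i < N := by simpa using hi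
    have : Ideal.ofList (((List.finRange N).map
        (X : Fin N → MvPolynomial (Fin N) ℂ)).take i) • (⊤ : Submodule (MvPolynomial (Fin N) ℂ) _)
        = Ideal.span (X '' {j : Fin N | j.1 < i}) := by
      rw [smul_eq_mul, Ideal.mul_top, Ideal.ofList]
      congr 1
      ext p
      simp only [← List.map_take, List.mem_map, Set.mem_ofPred_eq, Set.mem_image]
      refine exists_congr fun j => and_congr_left fun _ => ?_
      rw [List.mem_take_iff_getElem]
      constructor
      · rintro ⟨a, ha, rfl⟩
        simp at ha ⊢
        omega
      · intro hj
        exact ⟨j, by simp; omega, by simp⟩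
    rw [this]
    simp only [List.getElem_map, List.getElem_finRange]
    exact (X_nzd _ _ (by simp)).isSMulRegular
  · intro h
    rw [smul_eq_mul, Ideal.mul_top] at h
    have h1 : (1 : MvPolynomial (Fin N) ℂ) ∈ Ideal.span (X '' Set.univ) := by
      have : (1 : MvPolynomial (Fin N) ℂ) ∈ Ideal.ofList ((List.finRange N).map X) := by
        rw [← h]; trivial
      rw [Ideal.ofList] at this
      convert this using 3
      ext p; simp
    rw [mem_ideal_span_X_image] at h1
    have := h1 0 (by rw [mem_support_iff]; simp)
    simp at this

lemma varIdeal_ne_top : varIdeal N ≠ ⊤ := by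
  intro h
  have h1 : (1 : MvPolynomial (Fin N) ℂ) ∈ varIdeal N := by rw [h]; trivial
  rw [varIdeal, mem_ideal_span_X_image] at h1
  have := h1 0 (by rw [mem_support_iff]; simp)
  simp at this

lemma depthGE_bot [NeZero N] : DepthGE (varIdeal N) ⊥ N := by
  intro M hM hm i hi
  refine ModuleCat.subsingleton_ext_of_exists_isRegular (varIdeal N) M ?_
    (ModuleCat.of _ (MvPolynomial (Fin N) ℂ ⧸ (⊥ : Ideal _))) ?_ ((List.finRange N).map X) ?_
    (((Submodule.quotEquivOfEqBot (⊥ : Ideal (MvPolynomial (Fin N) ℂ)) rfl).isRegular_congr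
      _).2 isRegular_X) i (by simpa using hi)
  · rwa [Module.support_eq_zeroLocus, PrimeSpectrum.zeroLocus_subset_zeroLocus_iff]
  · rw [lt_top_iff_ne_top]
    intro h
    apply varIdeal_ne_top (N := N)
    have e := Submodule.quotEquivOfEqBot (⊥ : Ideal (MvPolynomial (Fin N) ℂ)) rfl
    have := congrArg (Submodule.map e.toLinearMap) h
    rw [Submodule.map_smul''] at this
    simpa using this
  · intro r hr
    obtain ⟨j, -, rfl⟩ := List.mem_map.1 hr
    exact Ideal.subset_span ⟨j, trivial, rfl⟩

lemma varIdeal_le_radical {J : Ideal (MvPolynomial (Fin N) ℂ)}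
    (h : ∀ x : Fin N → ℂ, x ≠ 0 → ∃ p ∈ J, eval x p ≠ 0) : varIdeal N ≤ J.radical := by
  rw [← vanishingIdeal_zeroLocus_eq_radical (K := ℂ), varIdeal, Ideal.span_le]
  rintro _ ⟨j, -, rfl⟩
  rw [SetLike.mem_coe, mem_vanishingIdeal_iff]
  intro x hx
  by_cases hx0 : x = 0
  · simp [hx0]
  · obtain ⟨p, hp, hne⟩ := h x hx0
    exact absurd (by simpa [aeval_eq_eval] using (mem_zeroLocus_iff.1 hx) p hp) hne
end Vars

section Geometry

variable {N m : ℕ} (F : Fin m → MvPolynomial (Fin N) ℂ)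

/-- The ideal `(F_i : i ∈ s)`. -/
noncomputable def idealOf (s : Finset (Fin m)) : Ideal (MvPolynomial (Fin N) ℂ) :=
  Ideal.span (Set.image F s)

/-- At every nonzero point the differentials of the `F_i` vanishing there are independent. -/
def NormalCrossings : Prop :=
  ∀ x : Fin N → ℂ, x ≠ 0 →
    LinearIndependent ℂ (fun i : {i : Fin m // eval x (F i) = 0} =>
      (fun k => eval x (pderiv k (F i.1)) : Fin N → ℂ))

variable {F}

lemma idealOf_insert (s : Finset (Fin m)) (k : Fin m) :
    idealOf F (insert k s) = idealOf F s ⊔ Ideal.span {F k} := by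
  rw [idealOf, idealOf, Finset.coe_insert, Set.image_insert_eq, Ideal.span_insert, sup_comm]

lemma mem_idealOf {s : Finset (Fin m)} {k : Fin m} (hk : k ∈ s) : F k ∈ idealOf F s :=
  Ideal.subset_span ⟨k, hk, rfl⟩

lemma idealOf_mono {s t : Finset (Fin m)} (h : s ⊆ t) : idealOf F s ≤ idealOf F t :=
  Ideal.span_mono (Set.image_mono (by exact_mod_cast h))

/-- The derivation along a polynomial vector field. -/
noncomputable def fieldDeriv (v : Fin N → MvPolynomial (Fin N) ℂ) :
    Derivation ℂ (MvPolynomial (Fin N) ℂ) (MvPolynomial (Fin N) ℂ) := ∑ l, v l • pderiv l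

lemma fieldDeriv_apply (v : Fin N → MvPolynomial (Fin N) ℂ) (p : MvPolynomial (Fin N) ℂ) :
    fieldDeriv v p = ∑ l, v l * pderiv l p := by
  rw [fieldDeriv, ← Derivation.coeFnAddMonoidHom_apply, map_sum, Finset.sum_apply]
  rfl

variable (F) in
/-- The polynomials `v(F_a)`, for `v` a polynomial vector field tangent to all other `F_b`. -/
noncomputable def transIdeal (t : Finset (Fin m)) (a : Fin m) :
    Ideal (MvPolynomial (Fin N) ℂ) where
  carrier := {δ | ∃ v : Fin N → MvPolynomial (Fin N) ℂ,
    ∀ b ∈ t, fieldDeriv v (F b) = if b = a then δ else 0}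
  zero_mem' := ⟨0, fun b _ => by simp [fieldDeriv_apply]⟩
  add_mem' := by
    rintro δ ε ⟨v, hv⟩ ⟨w, hw⟩
    refine ⟨v + w, fun b hb => ?_⟩
    have := congrArg₂ (· + ·) (hv b hb) (hw b hb)
    simp only [fieldDeriv_apply, ← Finset.sum_add_distrib] at this
    simp only [fieldDeriv_apply, Pi.add_apply, add_mul, this]
    split_ifs <;> simp
  smul_mem' := by
    rintro c δ ⟨v, hv⟩
    refine ⟨c • v, fun b hb => ?_⟩
    have := congrArg (c * ·) (hv b hb)
    simp only [fieldDeriv_apply, Finset.mul_sum] at this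
    simp only [fieldDeriv_apply, Pi.smul_apply, smul_eq_mul, mul_assoc, this]
    split_ifs <;> simp

lemma exists_dual_frame {ι : Type*} [Fintype ι] [DecidableEq ι] {A : ι → Fin N → ℂ}
    (h : LinearIndependent ℂ A) :
    ∃ c : ι → Fin N → ℂ, ∀ a b, ∑ l, c b l * A a l = if a = b then 1 else 0 := by
  have hinj := Matrix.vecMul_injective_iff.2 (show LinearIndependent ℂ (Matrix.row (Matrix.of A))
    from h)
  obtain ⟨g, hg⟩ := LinearMap.exists_leftInverse_of_injective (Matrix.vecMulLinear (Matrix.of A))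
    (LinearMap.ker_eq_bot.2 hinj)
  refine ⟨fun b l => g (Pi.single l 1) b, fun a b => ?_⟩
  have h1 := congrFun (congrArg (fun f => f (Pi.single a 1)) hg) b
  simp only [LinearMap.comp_apply, Matrix.vecMulLinear_apply, Matrix.single_one_vecMul,
    LinearMap.id_apply] at h1
  have h2 : (Matrix.of A) a = ∑ l, A a l • (Pi.single l 1 : Fin N → ℂ) := by
    ext l; simp [Finset.sum_apply, Pi.single_apply]
  have h3 : (Matrix.of A).row a = (Matrix.of A) a := rfl
  rw [h3, h2, map_sum, Finset.sum_apply] at h1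
  simp only [map_smul, Pi.smul_apply, smul_eq_mul, Pi.single_apply] at h1
  simp only [mul_comm (g _ b)]
  rw [h1]
  simp [eq_comm]

lemma exists_mem_transIdeal (hF : NormalCrossings F) {t : Finset (Fin m)} {a : Fin m}
    (ha : a ∈ t) {x : Fin N → ℂ} (hx : x ≠ 0) (h : ∀ b ∈ t, eval x (F b) = 0) :
    ∃ δ ∈ transIdeal F t a, eval x δ ≠ 0 := by
  classical
  have hli : LinearIndependent ℂ (fun b : t => (fun k => eval x (pderiv k (F b)) : Fin N → ℂ)) :=
    (hF x hx).comp (fun b : t => ⟨b.1, h b.1 b.2⟩) (fun b c hbc =>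
      Subtype.ext (congrArg (fun z => z.1) hbc))
  obtain ⟨c, hc⟩ := exists_dual_frame hli
  let M : Matrix t t (MvPolynomial (Fin N) ℂ) :=
    Matrix.of fun a b => ∑ l, C (c b l) * pderiv l (F a)
  refine ⟨M.det, ⟨fun l => ∑ b : t, M.adjugate b ⟨a, ha⟩ * C (c b l), fun b hb => ?_⟩, ?_⟩
  · have h1 := congrFun (congrFun M.mul_adjugate ⟨b, hb⟩) ⟨a, ha⟩
    rw [Matrix.mul_apply] at h1
    rw [fieldDeriv_apply]
    have h2 : (M.det • (1 : Matrix t t (MvPolynomial (Fin N) ℂ))) ⟨b, hb⟩ ⟨a, ha⟩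
        = if b = a then M.det else 0 := by
      simp [Matrix.one_apply]
    rw [← h2, ← h1]
    simp only [Finset.sum_mul, M, Matrix.of_apply]
    rw [Finset.sum_comm]
    refine Finset.sum_congr rfl fun e _ => Finset.sum_congr rfl fun l _ => ?_
    ring
  · rw [RingHom.map_det]
    have : (eval x).mapMatrix M = 1 := by
      ext a b
      simp only [M, RingHom.mapMatrix_apply, Matrix.map_apply, Matrix.of_apply, map_sum, map_mul,
        eval_C, Matrix.one_apply]
      exact hc a b
    rw [this, Matrix.det_one]
    exact one_ne_zero

lemma varIdeal_le_radical_trans (hF : NormalCrossings F) {t : Finset (Fin m)} {a : Fin m}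
    (ha : a ∈ t) : varIdeal N ≤ (idealOf F t ⊔ transIdeal F t a).radical := by
  refine varIdeal_le_radical fun x hx => ?_
  by_cases h : ∀ b ∈ t, eval x (F b) = 0
  · obtain ⟨δ, hδ, hne⟩ := exists_mem_transIdeal hF ha hx h
    exact ⟨δ, Ideal.mem_sup_right hδ, hne⟩
  · push Not at h
    obtain ⟨b, hb, hne⟩ := h
    exact ⟨F b, Ideal.mem_sup_left (mem_idealOf hb), hne⟩

lemma fieldDeriv_mem {s : Finset (Fin m)} {v : Fin N → MvPolynomial (Fin N) ℂ}
    (hv : ∀ b ∈ s, fieldDeriv v (F b) = 0) {p : MvPolynomial (Fin N) ℂ} (hp : p ∈ idealOf F s) :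
    fieldDeriv v p ∈ idealOf F s := by
  induction hp using Submodule.span_induction with
  | mem x hx =>
    obtain ⟨b, hb, rfl⟩ := hx
    rw [hv b (by exact_mod_cast hb)]
    exact zero_mem _
  | zero => simp
  | add x y _ _ hx hy => rw [map_add]; exact add_mem hx hy
  | smul c x hx h =>
    rw [smul_eq_mul, Derivation.leibniz]
    exact add_mem (Ideal.mul_mem_left _ _ h) (by
      rw [smul_eq_mul]; exact Ideal.mul_mem_right _ _ hx)

/-- A depth one Jacobian criterion for regularity: the torsion is stable under the vector
fields tangent to `s`, which forces it to be supported at the origin. -/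
lemma nzd_of_depthGE (hF : NormalCrossings F) {s : Finset (Fin m)} {k : Fin m} (hk : k ∉ s)
    (hd : DepthGE (varIdeal N) (idealOf F s) 1) : NZD (idealOf F s) (F k) := by
  set I := idealOf F s
  let T : ℕ →o Ideal (MvPolynomial (Fin N) ℂ) :=
    ⟨fun e => Submodule.comap (LinearMap.mulLeft _ (F k ^ e)) I, by
      refine monotone_nat_of_le_succ fun e u hu => ?_
      rw [Submodule.mem_comap, LinearMap.mulLeft_apply] at hu ⊢
      rw [pow_succ', mul_assoc]
      exact Ideal.mul_mem_left _ _ hu⟩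
  have hT : ∀ e u, u ∈ T e ↔ F k ^ e * u ∈ I := fun e u => Iff.rfl
  have step : ∀ e, T (e + 1) = T (e + 2) → T e = T (e + 1) := by
    intro e he
    refine le_antisymm (T.monotone (Nat.le_succ e)) fun u hu => ?_
    rw [hT]
    refine hd.mem_of_forall_mul_mem (varIdeal_le_radical_trans hF (mem_insert_self k s)) ?_
    intro j hj
    obtain ⟨p, hp, δ, hδ, rfl⟩ := Submodule.mem_sup.1 hj
    rw [add_mul]
    refine add_mem ?_ ?_
    · rw [idealOf_insert] at hp
      obtain ⟨q, hq, r, hr, rfl⟩ := Submodule.mem_sup.1 hp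
      obtain ⟨c, rfl⟩ := Ideal.mem_span_singleton'.1 hr
      rw [add_mul]
      refine add_mem (Ideal.mul_mem_right _ _ hq) ?_
      have := Ideal.mul_mem_left I c ((hT _ _).1 hu)
      convert this using 1
      ring
    · obtain ⟨v, hv⟩ := hδ
      have hvs : ∀ b ∈ s, fieldDeriv v (F b) = 0 := fun b hb => by
        rw [hv b (mem_insert_of_mem hb), if_neg]
        rintro rfl
        exact hk hb
      have hvk : fieldDeriv v (F k) = δ := by rw [hv k (mem_insert_self k s), if_pos rfl]
      have hD : F k ^ (e + 1) * fieldDeriv v u + ((e : ℂ) + 1) • (F k ^ e * δ * u) ∈ I := by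
        have := fieldDeriv_mem hvs ((hT _ _).1 hu)
        rw [Derivation.leibniz, Derivation.leibniz_pow, hvk] at this
        convert this using 1
        simp only [smul_eq_mul, Algebra.smul_def, Nat.add_sub_cancel]
        simp
        ring
      have hDu : fieldDeriv v u ∈ T (e + 1) := by
        rw [he, hT]
        have := Ideal.sub_mem _ (Ideal.mul_mem_left I (F k) hD)
          (Ideal.mul_mem_left I (C ((e : ℂ) + 1) * δ) ((hT _ _).1 hu))
        convert this using 1
        simp only [smul_eq_C_mul]
        ring
      have h1 := (Submodule.add_mem_iff_right I ((hT _ _).1 hDu)).1 hD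
      have h2 := Ideal.mul_mem_left I (C ((e : ℂ) + 1)⁻¹) h1
      convert h2 using 1
      have hC : C ((e : ℂ) + 1)⁻¹ * C ((e : ℂ) + 1) = (1 : MvPolynomial (Fin N) ℂ) := by
        rw [← C_mul, inv_mul_cancel₀ (Nat.cast_add_one_ne_zero e), C_1]
      rw [smul_eq_C_mul]
      linear_combination (-(F k ^ e * δ * u)) * hC
  obtain ⟨n, hn⟩ := monotone_stabilizes_iff_noetherian.2
    (inferInstanceAs (IsNoetherian (MvPolynomial (Fin N) ℂ) (MvPolynomial (Fin N) ℂ))) T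
  have down : ∀ j e, e + j = n → T e = T (e + 1) := by
    intro j
    induction j with
    | zero => intro e he; subst he; exact hn _ (Nat.le_succ _)
    | succ j ih => intro e he; exact step e (ih (e + 1) (by omega))
  have h01 := down n 0 (by omega)
  intro u hu
  have : u ∈ T 0 := by
    rw [h01, hT]
    simpa using hu
  simpa [hT] using this

lemma depthGE_idealOf [NeZero N] (hF : NormalCrossings F) (s : Finset (Fin m)) :
    ∀ k, s.card + k ≤ N → DepthGE (varIdeal N) (idealOf F s) k := by
  induction s using Finset.induction_on with
  | empty =>
    intro k hk M hM hm i hi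
    have : idealOf F ∅ = ⊥ := by simp [idealOf]
    rw [this]
    exact depthGE_bot M hM hm i (by simp at hk; omega)
  | insert a s ha ih =>
    intro k hk
    rw [card_insert_of_notMem ha] at hk
    rw [idealOf_insert]
    exact (ih (k + 1) (by omega)).sup_span (nzd_of_depthGE hF ha (ih 1 (by omega)))

lemma nzd_idealOf [NeZero N] (hF : NormalCrossings F) {s : Finset (Fin m)} (hs : s.card < N)
    {k : Fin m} (hk : k ∉ s) : NZD (idealOf F s) (F k) :=
  nzd_of_depthGE hF hk (depthGE_idealOf hF s 1 hs)

/-- The differentials `dF_a`, `a ∈ s`, are linearly independent modulo `(F_a : a ∈ s)`. -/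
lemma coeff_mem_idealOf [NeZero N] (hF : NormalCrossings F) {s : Finset (Fin m)} (hs : s.card < N)
    {c : Fin m → MvPolynomial (Fin N) ℂ}
    (h : ∀ l, ∑ a ∈ s, c a * pderiv l (F a) ∈ idealOf F s) {a : Fin m} (ha : a ∈ s) :
    c a ∈ idealOf F s := by
  refine (depthGE_idealOf hF s 1 hs).mem_of_forall_mul_mem (varIdeal_le_radical_trans hF ha) ?_
  intro j hj
  obtain ⟨p, hp, δ, ⟨v, hv⟩, rfl⟩ := Submodule.mem_sup.1 hj
  rw [add_mul]
  refine add_mem (Ideal.mul_mem_right _ _ hp) ?_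
  have h1 : ∑ l, v l * ∑ b ∈ s, c b * pderiv l (F b) ∈ idealOf F s :=
    Submodule.sum_mem _ fun l _ => Ideal.mul_mem_left _ _ (h l)
  convert h1 using 1
  simp only [Finset.mul_sum]
  rw [Finset.sum_comm]
  have h2 : ∀ b ∈ s, ∑ l, v l * (c b * pderiv l (F b)) = c b * if b = a then δ else 0 := by
    intro b hb
    rw [← hv b hb, fieldDeriv_apply, Finset.mul_sum]
    exact Finset.sum_congr rfl fun l _ => by ring
  rw [Finset.sum_congr rfl h2]
  simp [ha, mul_comm]

end Geometry

section Structure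

variable {N m : ℕ} {F : Fin m → S N}

lemma logForm_eq (lam : Fin m → ℂ) (s : Finset (Fin m)) : ∃ ρ : Form1 N, ∀ l,
    logForm lam F l = (∏ a ∈ sᶜ, F a) * ∑ a ∈ s, C (lam a) * (∏ b ∈ s.erase a, F b) *
      pderiv l (F a) + (∏ a ∈ s, F a) * ρ l := by
  refine ⟨fun l => ∑ a ∈ sᶜ, C (lam a) * (∏ b ∈ sᶜ.erase a, F b) * pderiv l (F a), fun l => ?_⟩
  rw [logForm, ← Finset.sum_add_sum_compl s, Finset.mul_sum, Finset.mul_sum]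
  refine congrArg₂ (· + ·) ?_ ?_
  · refine Finset.sum_congr rfl fun a ha => ?_
    have : univ.erase a = (s.erase a) ∪ sᶜ := by
      ext b; by_cases hb : b = a <;> by_cases hs : b ∈ s <;> simp_all
    rw [Fhat, this, Finset.prod_union (disjoint_compl_right.mono_left (Finset.erase_subset a s))]
    ring
  · refine Finset.sum_congr rfl fun a ha => ?_
    have : univ.erase a = s ∪ sᶜ.erase a := by
      ext b; by_cases hb : b = a <;> by_cases hs : b ∈ s <;> simp_all
    rw [Fhat, this, Finset.prod_union (disjoint_compl_right.mono_right (Finset.erase_subset a _))]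
    ring

lemma coeff_mem_pair [NeZero N] (hF : NormalCrossings F) (hN : 4 ≤ N) {i j : Fin m} (hij : i ≠ j)
    {x y : S N} (h : ∀ l, x * pderiv l (F i) + y * pderiv l (F j) ∈ idealOf F {i, j}) :
    x ∈ idealOf F {i, j} ∧ y ∈ idealOf F {i, j} := by
  have key := fun a => coeff_mem_idealOf hF (s := {i, j}) (a := a)
    (c := fun a => if a = i then x else y)
    (by rw [card_pair hij]; omega)
    (fun l => by simpa [Finset.sum_pair hij, hij.symm] using h l)
  have h1 := key i (by simp)
  have h2 := key j (by simp)
  simp only [if_true, if_neg hij.symm] at h1 h2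
  exact ⟨h1, h2⟩

lemma coeff_mem_triple [NeZero N] (hF : NormalCrossings F) (hN : 4 ≤ N) {i j k : Fin m}
    (hij : i ≠ j) (hik : i ≠ k) (hjk : j ≠ k) {x y z : S N}
    (h : ∀ l, x * pderiv l (F i) + y * pderiv l (F j) + z * pderiv l (F k) ∈ idealOf F {i, j, k}) :
    x ∈ idealOf F {i, j, k} ∧ y ∈ idealOf F {i, j, k} ∧ z ∈ idealOf F {i, j, k} := by
  have key := fun a => coeff_mem_idealOf hF (s := {i, j, k}) (a := a)
    (c := fun a => if a = i then x else if a = j then y else z)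
    (by rw [card_eq_three.2 ⟨i, j, k, hij, hik, hjk, rfl⟩]; omega)
    (fun l => by
      rw [Finset.sum_insert (by simp [hij, hik]), Finset.sum_pair hjk]
      simpa [hij.symm, hik.symm, hjk.symm, add_assoc] using h l)
  have h1 := key i (by simp)
  have h2 := key j (by simp)
  have h3 := key k (by simp)
  simp only [if_true, if_neg hij.symm, if_neg hik.symm, if_neg hjk.symm] at h1 h2 h3
  exact ⟨h1, h2, h3⟩

lemma mem_sup_span_prod {R ι : Type} [CommRing R] {I : Ideal R} {f : ι → R} {T : Finset ι}
    (hT : ∀ k ∈ T, ∀ t ∈ T, t ≠ k → NZD (I ⊔ Ideal.span {f k}) (f t)) {a : R}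
    (ha : ∀ k ∈ T, a ∈ I ⊔ Ideal.span {f k}) :
    ∃ c, a - c * ∏ k ∈ T, f k ∈ I := by
  classical
  induction T using Finset.induction_on with
  | empty => exact ⟨a, by simp⟩
  | insert t T ht ih =>
    obtain ⟨c, hc⟩ := ih (fun k hk s hs => hT k (mem_insert_of_mem hk) s (mem_insert_of_mem hs))
      (fun k hk => ha k (mem_insert_of_mem hk))
    have h1 : (∏ k ∈ T, f k) * c ∈ I ⊔ Ideal.span {f t} := by
      have := Ideal.sub_mem _ (ha t (mem_insert_self t T)) (Ideal.mem_sup_left hc)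
      convert this using 1
      ring
    have h2 : NZD (I ⊔ Ideal.span {f t}) (∏ k ∈ T, f k) := NZD.prod fun k hk =>
      hT t (mem_insert_self t T) k (mem_insert_of_mem hk) (by rintro rfl; exact ht hk)
    obtain ⟨y, hy, z, hz, hyz⟩ := Submodule.mem_sup.1 (h2 _ h1)
    obtain ⟨e, rfl⟩ := Ideal.mem_span_singleton'.1 hz
    refine ⟨e, ?_⟩
    rw [Finset.prod_insert ht]
    have := Ideal.add_mem _ hc (Ideal.mul_mem_right (∏ k ∈ T, f k) I hy)
    convert this using 1
    rw [← hyz]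
    ring

lemma exists_sub_mul_prod_mem [NeZero N] (hF : NormalCrossings F) {s T : Finset (Fin m)}
    (hs : s.card + 1 < N) (hd : Disjoint s T) {a : S N}
    (ha : ∀ k ∈ T, a ∈ idealOf F (insert k s)) : ∃ c, a - c * ∏ k ∈ T, F k ∈ idealOf F s := by
  refine mem_sup_span_prod (fun k hk t ht htk => ?_) (fun k hk => ?_)
  · rw [← idealOf_insert]
    refine nzd_idealOf hF (lt_of_le_of_lt (card_insert_le _ _) hs) ?_
    simp [htk, Finset.disjoint_right.1 hd ht]
  · rw [← idealOf_insert]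
    exact ha k hk

lemma nzd_prod_compl [NeZero N] (hF : NormalCrossings F) {s : Finset (Fin m)} (hs : s.card < N) :
    NZD (idealOf F s) (∏ k ∈ sᶜ, F k) :=
  NZD.prod fun _ hk => nzd_idealOf hF hs (Finset.mem_compl.1 hk)

lemma Fhat2_eq (i j : Fin m) : Fhat2 F i j = ∏ k ∈ ({i, j} : Finset (Fin m))ᶜ, F k := by
  rw [Fhat2]
  congr 1
  ext k
  simp [and_comm]

lemma wedge_mem [NeZero N] (hF : NormalCrossings F) (hN : 4 ≤ N) {lam : Fin m → ℂ} {α : Form1 N}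
    (ht : TangentZero (logForm lam F) α) {i j : Fin m} (hij : i ≠ j) (hl : lam i ≠ lam j)
    (p q r : Fin N) : w12 α (w11 (Dp (F i)) (Dp (F j))) p q r ∈ idealOf F {i, j} := by
  obtain ⟨ρ, hρ⟩ := logForm_eq (F := F) lam {i, j}
  set G := ∏ a ∈ ({i, j} : Finset (Fin m))ᶜ, F a with hG
  have hω : logForm lam F = fun l => G * (C (lam i) * F j * pderiv l (F i) +
      C (lam j) * F i * pderiv l (F j)) + F i * F j * ρ l := by
    funext l
    rw [hρ l, Finset.sum_pair hij, Finset.prod_pair hij]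
    have h1 : ({i, j} : Finset (Fin m)).erase i = {j} := by ext; simp; grind
    have h2 : ({i, j} : Finset (Fin m)).erase j = {i} := by ext; simp; grind
    rw [h1, h2, Finset.prod_singleton, Finset.prod_singleton]
  have hnzd : NZD (idealOf F {i, j}) G :=
    nzd_prod_compl hF (by rw [card_pair hij]; omega)
  have hi : Ideal.Quotient.mk (idealOf F {i, j}) (F i) = 0 :=
    Ideal.Quotient.eq_zero_iff_mem.2 (mem_idealOf (by simp))
  have hj : Ideal.Quotient.mk (idealOf F {i, j}) (F j) = 0 :=
    Ideal.Quotient.eq_zero_iff_mem.2 (mem_idealOf (by simp))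
  have h0 := congrArg (Ideal.Quotient.mk (idealOf F {i, j})) (ht p q r)
  have h1 : G * (C (lam j - lam i) * w12 α (w11 (Dp (F i)) (Dp (F j))) p q r) ∈
      idealOf F {i, j} := by
    rw [← Ideal.Quotient.eq_zero_iff_mem]
    rw [map_zero] at h0
    rw [← h0, hω]
    simp only [w12, extD, w11, Dp, map_add, map_sub, map_mul, pderiv_mul, pderiv_C, hi, hj]
    ring
  have h2 := Ideal.mul_mem_left _ (C (lam j - lam i)⁻¹) (hnzd _ h1)
  rwa [← mul_assoc, ← C_mul, inv_mul_cancel₀ (sub_ne_zero.2 hl.symm), C_1, one_mul] at h2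

lemma sum_mul_linear (w a b c : Fin N → S N) (x y z : S N) :
    ∑ r, w r * (x * a r - y * b r + z * c r) =
      x * ∑ r, w r * a r - y * ∑ r, w r * b r + z * ∑ r, w r * c r := by
  simp only [Finset.mul_sum, ← Finset.sum_add_distrib, ← Finset.sum_sub_distrib]
  exact Finset.sum_congr rfl fun r _ => by ring

lemma sum_mul_w12_w11 (v w α f g : Fin N → S N) (p : Fin N) :
    ∑ q, v q * ∑ r, w r * w12 α (w11 f g) p q r =
      α p * ((∑ q, v q * f q) * (∑ q, w q * g q) - (∑ q, w q * f q) * (∑ q, v q * g q)) -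
      (∑ q, v q * α q) * (f p * (∑ q, w q * g q) - g p * ∑ q, w q * f q) +
      (∑ q, w q * α q) * (f p * (∑ q, v q * g q) - g p * ∑ q, v q * f q) := by
  have h1 : ∀ q, ∑ r, w r * w12 α (w11 f g) p q r =
      (α p * f q - α q * f p) * (∑ r, w r * g r) - (α p * g q - α q * g p) * (∑ r, w r * f r)
        + (f p * g q - f q * g p) * ∑ r, w r * α r := by
    intro q
    rw [← sum_mul_linear]
    refine Finset.sum_congr rfl fun r _ => ?_
    simp only [w12, w11]
    ring
  have h2 := sum_mul_linear v f g α (α p * (∑ r, w r * g r) - g p * ∑ r, w r * α r)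
    (α p * (∑ r, w r * f r) - f p * ∑ r, w r * α r)
    (g p * (∑ r, w r * f r) - f p * ∑ r, w r * g r)
  have h3 : ∑ q, v q * ∑ r, w r * w12 α (w11 f g) p q r = ∑ q, v q *
      ((α p * (∑ r, w r * g r) - g p * ∑ r, w r * α r) * f q -
      (α p * (∑ r, w r * f r) - f p * ∑ r, w r * α r) * g q +
      (g p * (∑ r, w r * f r) - f p * ∑ r, w r * g r) * α q) :=
    Finset.sum_congr rfl fun q _ => by rw [h1]; ring
  rw [h3, h2]
  ring

variable (F) in
/-- The polynomials `f` such that `f α` is a combination of `dF_i`, `dF_j` modulo `(F_i, F_j)`. -/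
noncomputable def combIdeal (α : Form1 N) (i j : Fin m) : Ideal (S N) where
  carrier := {f | ∃ a b : S N, ∀ l, f * α l - (a * pderiv l (F i) + b * pderiv l (F j)) ∈
    idealOf F {i, j}}
  zero_mem' := ⟨0, 0, fun l => by simp⟩
  add_mem' := by
    rintro f g ⟨a, b, h⟩ ⟨a', b', h'⟩
    refine ⟨a + a', b + b', fun l => ?_⟩
    convert add_mem (h l) (h' l) using 1
    ring
  smul_mem' := by
    rintro c f ⟨a, b, h⟩
    refine ⟨c * a, c * b, fun l => ?_⟩
    convert Ideal.mul_mem_left _ c (h l) using 1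
    rw [smul_eq_mul]
    ring

lemma varIdeal_le_radical_combIdeal (hF : NormalCrossings F) {α : Form1 N} {i j : Fin m}
    (hij : i ≠ j)
    (h : ∀ p q r, w12 α (w11 (Dp (F i)) (Dp (F j))) p q r ∈ idealOf F {i, j}) :
    varIdeal N ≤ (combIdeal F α i j).radical := by
  refine varIdeal_le_radical fun x hx => ?_
  by_cases hx0 : ∀ b ∈ ({i, j} : Finset (Fin m)), eval x (F b) = 0
  · obtain ⟨δ, ⟨v, hv⟩, hδ⟩ := exists_mem_transIdeal hF (a := i) (by simp) hx hx0
    obtain ⟨ε, ⟨w, hw⟩, hε⟩ := exists_mem_transIdeal hF (a := j) (by simp) hx hx0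
    have hvi := hv i (by simp)
    have hvj := hv j (by simp)
    have hwi := hw i (by simp)
    have hwj := hw j (by simp)
    rw [fieldDeriv_apply] at hvi hvj hwi hwj
    refine ⟨δ * ε, ⟨(∑ q, v q * α q) * ε, (∑ q, w q * α q) * δ, fun l => ?_⟩,
      by simpa using ⟨hδ, hε⟩⟩
    have hs : ∑ q, v q * ∑ r, w r * w12 α (w11 (Dp (F i)) (Dp (F j))) l q r ∈ idealOf F {i, j} :=
      Submodule.sum_mem _ fun q _ => Ideal.mul_mem_left _ _ <|
        Submodule.sum_mem _ fun r _ => Ideal.mul_mem_left _ _ (h l q r)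
    rw [sum_mul_w12_w11] at hs
    simp only [Dp] at hs
    rw [hvi, hvj, hwi, hwj, if_pos rfl, if_pos rfl, if_neg hij, if_neg hij.symm] at hs
    convert hs using 1
    ring
  · push Not at hx0
    obtain ⟨b, hb, hne⟩ := hx0
    refine ⟨F b, ⟨0, 0, fun l => ?_⟩, hne⟩
    simpa using Ideal.mul_mem_right _ _ (mem_idealOf hb)

/-- A division lemma: `α ∧ dF_i ∧ dF_j ≡ 0` modulo `(F_i, F_j)` forces `α` to be a combination
of `dF_i` and `dF_j` modulo `(F_i, F_j)`. -/
lemma exists_comb [NeZero N] (hF : NormalCrossings F) (hN : 4 ≤ N) {α : Form1 N} {i j : Fin m}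
    (hij : i ≠ j)
    (h : ∀ p q r, w12 α (w11 (Dp (F i)) (Dp (F j))) p q r ∈ idealOf F {i, j}) :
    ∃ a b : S N, ∀ l, α l - (a * pderiv l (F i) + b * pderiv l (F j)) ∈ idealOf F {i, j} := by
  have hrad := varIdeal_le_radical_combIdeal hF hij h
  have hdepth := depthGE_idealOf hF {i, j} 2 (by rw [card_pair hij]; omega)
  obtain ⟨f, ⟨a, b, hab⟩, hf⟩ := hdepth.exists_nzd hrad
  have hd1 := hdepth.sup_span hf
  have key : ∀ g ∈ combIdeal F α i j, g * a ∈ idealOf F {i, j} ⊔ Ideal.span {f} ∧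
      g * b ∈ idealOf F {i, j} ⊔ Ideal.span {f} := by
    rintro g ⟨a', b', hab'⟩
    obtain ⟨h1, h2⟩ := coeff_mem_pair hF hN hij (x := g * a - f * a') (y := g * b - f * b')
      (fun l => by
        convert Ideal.sub_mem _ (Ideal.mul_mem_left _ f (hab' l))
          (Ideal.mul_mem_left _ g (hab l)) using 1
        ring)
    have hfm : ∀ c, f * c ∈ idealOf F {i, j} ⊔ Ideal.span {f} := fun c =>
      Ideal.mem_sup_right (Ideal.mul_mem_right _ _ (Ideal.mem_span_singleton_self f))
    constructor
    · simpa using add_mem (Ideal.mem_sup_left h1) (hfm a')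
    · simpa using add_mem (Ideal.mem_sup_left h2) (hfm b')
  obtain ⟨y, hy, z, hz, rfl⟩ := Submodule.mem_sup.1
    (hd1.mem_of_forall_mul_mem hrad fun g hg => (key g hg).1)
  obtain ⟨y', hy', z', hz', rfl⟩ := Submodule.mem_sup.1
    (hd1.mem_of_forall_mul_mem hrad fun g hg => (key g hg).2)
  obtain ⟨c, rfl⟩ := Ideal.mem_span_singleton'.1 hz
  obtain ⟨c', rfl⟩ := Ideal.mem_span_singleton'.1 hz'
  refine ⟨c, c', fun l => hf _ ?_⟩
  convert add_mem (hab l) (add_mem (Ideal.mul_mem_right (pderiv l (F i)) _ hy)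
    (Ideal.mul_mem_right (pderiv l (F j)) _ hy')) using 1
  ring

/-- On `{F_i = F_j = 0}` the form `α` is divisible by `∏_{k ≠ i, j} F_k`. -/
lemma exists_comb_mul_prod [NeZero N] (hF : NormalCrossings F) (hN : 4 ≤ N) {lam : Fin m → ℂ}
    (hlam : ∀ i j, i ≠ j → lam i ≠ lam j) {α : Form1 N}
    (ht : TangentZero (logForm lam F) α) {i j : Fin m} (hij : i ≠ j) :
    ∃ a b : S N, ∀ l, α l - Fhat2 F i j * (a * pderiv l (F i) + b * pderiv l (F j)) ∈
      idealOf F {i, j} := by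
  have hcomb : ∀ i j, i ≠ j → ∃ a b : S N, ∀ l,
      α l - (a * pderiv l (F i) + b * pderiv l (F j)) ∈ idealOf F {i, j} := fun i j hij =>
    exists_comb hF hN hij fun p q r => wedge_mem hF hN ht hij (hlam i j hij) p q r
  obtain ⟨a, b, hab⟩ := hcomb i j hij
  have key : ∀ k ∈ ({i, j} : Finset (Fin m))ᶜ, a ∈ idealOf F (insert k {i, j}) ∧
      b ∈ idealOf F (insert k {i, j}) := by
    intro k hk
    have hk' : k ≠ i ∧ k ≠ j := by simpa using hk
    obtain ⟨hki, hkj⟩ := hk'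
    obtain ⟨a1, b1, h1⟩ := hcomb k i hki
    obtain ⟨a2, b2, h2⟩ := hcomb k j hkj
    have s0 : ({i, j} : Finset (Fin m)) ⊆ {k, i, j} := by intro; simp; tauto
    have s1 : ({k, i} : Finset (Fin m)) ⊆ {k, i, j} := by intro; simp; tauto
    have s2 : ({k, j} : Finset (Fin m)) ⊆ {k, i, j} := by intro; simp; tauto
    constructor
    · refine (coeff_mem_triple hF hN hki hkj hij (x := -a2) (y := a) (z := b - b2)
        fun l => ?_).2.1
      convert Ideal.sub_mem _ (idealOf_mono s2 (h2 l)) (idealOf_mono s0 (hab l)) using 1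
      ring
    · refine (coeff_mem_triple hF hN hki hkj hij (x := -a1) (y := a - b1) (z := b)
        fun l => ?_).2.2
      convert Ideal.sub_mem _ (idealOf_mono s1 (h1 l)) (idealOf_mono s0 (hab l)) using 1
      ring
  have hcard : ({i, j} : Finset (Fin m)).card + 1 < N := by rw [card_pair hij]; omega
  obtain ⟨a', ha'⟩ := exists_sub_mul_prod_mem hF hcard disjoint_compl_right fun k hk => (key k hk).1
  obtain ⟨b', hb'⟩ := exists_sub_mul_prod_mem hF hcard disjoint_compl_right fun k hk => (key k hk).2
  refine ⟨a', b', fun l => ?_⟩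
  rw [Fhat2_eq]
  convert add_mem (hab l) (add_mem (Ideal.mul_mem_right (pderiv l (F i)) _ ha')
    (Ideal.mul_mem_right (pderiv l (F j)) _ hb')) using 1
  ring

lemma Fhat2_comm (i j : Fin m) : Fhat2 F i j = Fhat2 F j i := by
  rw [Fhat2, Fhat2, Finset.erase_right_comm]

lemma exists_coeffs [NeZero N] (hF : NormalCrossings F) (hN : 4 ≤ N) {lam : Fin m → ℂ}
    (hlam : ∀ i j, i ≠ j → lam i ≠ lam j) {α : Form1 N}
    (ht : TangentZero (logForm lam F) α) :
    ∃ A : Fin m → Fin m → S N, ∀ i j, i ≠ j → ∀ l,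
      α l - Fhat2 F i j * (A i j * pderiv l (F i) + A j i * pderiv l (F j)) ∈
        idealOf F {i, j} := by
  have h := fun i j (hij : i ≠ j) => exists_comb_mul_prod hF hN hlam ht hij
  choose P Q hPQ using h
  refine ⟨fun i j => if h : i < j then P i j h.ne else if h' : j < i then Q j i h'.ne else 0,
    fun i j hij l => ?_⟩
  rcases lt_or_gt_of_ne hij with h | h
  · simpa [h, h.not_gt] using hPQ i j hij l
  · have := hPQ j i hij.symm l
    rw [Fhat2_comm, Finset.pair_comm, add_comm (_ * _)] at this
    simpa [h, h.not_gt] using this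

/-- The gluing step: polynomials `B_i` agreeing on triple intersections come from one polynomial
modulo `(F_i, F_j)`. -/
lemma exists_glue [NeZero N] (hF : NormalCrossings F) (hN : 4 ≤ N) {j : Fin m}
    {B : Fin m → S N}
    (hB : ∀ i k, i ≠ j → k ≠ j → i ≠ k → B i - B k ∈ idealOf F {i, j, k})
    (T : Finset (Fin m)) (hT : j ∉ T) : ∃ f, ∀ i ∈ T, f - B i ∈ idealOf F {i, j} := by
  induction T using Finset.induction_on with
  | empty => exact ⟨0, by simp⟩
  | insert k T hk ih =>
    rw [Finset.mem_insert, not_or] at hT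
    obtain ⟨f, hf⟩ := ih hT.2
    obtain ⟨c, hc⟩ := exists_sub_mul_prod_mem hF (s := {k, j}) (T := T) (a := f - B k)
      (by rw [card_pair (Ne.symm hT.1)]; omega)
      (by simp [hk, hT.2]) (fun i hi => by
        have hij : i ≠ j := by rintro rfl; exact hT.2 hi
        have hik : i ≠ k := by rintro rfl; exact hk hi
        have s0 : ({i, j} : Finset (Fin m)) ⊆ {i, k, j} := by intro; simp; tauto
        have s1 : ({i, j, k} : Finset (Fin m)) ⊆ {i, k, j} := by intro; simp; tauto
        simpa using add_mem (idealOf_mono s0 (hf i hi))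
          (idealOf_mono s1 (hB i k hij (Ne.symm hT.1) hik)))
    refine ⟨f - c * ∏ i ∈ T, F i, fun i hi => ?_⟩
    rcases Finset.mem_insert.1 hi with rfl | hi
    · convert hc using 1
      ring
    · have h1 : c * ∏ i ∈ T, F i ∈ idealOf F {i, j} := by
        rw [← Finset.mul_prod_erase T F hi]
        exact Ideal.mul_mem_left _ _ (Ideal.mul_mem_right _ _ (mem_idealOf (by simp)))
      convert Ideal.sub_mem _ (hf i hi) h1 using 1
      ring

lemma pderiv_comm (p q : Fin N) (f : S N) : pderiv p (pderiv q f) = pderiv q (pderiv p f) := by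
  have h : ⁅pderiv (R := ℂ) p, pderiv (R := ℂ) q⁆ = 0 := by
    refine MvPolynomial.derivation_ext fun i => ?_
    rw [Derivation.commutator_apply]
    by_cases hp : i = p <;> by_cases hq : i = q <;> simp [pderiv_X, Pi.single_apply, hp, hq] <;>
      split_ifs <;> simp
  have h1 := congrArg (fun D => D f) h
  simp only [Derivation.commutator_apply, Derivation.zero_apply] at h1
  exact sub_eq_zero.1 h1

lemma mem_of_mul_det_mem [NeZero N] (hF : NormalCrossings F) (hN : 4 ≤ N) {i j k : Fin m}
    (hij : i ≠ j) (hik : i ≠ k) (hjk : j ≠ k) {E : S N}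
    (h : ∀ p q r, E * w12 (Dp (F j)) (w11 (Dp (F i)) (Dp (F k))) p q r ∈ idealOf F {i, j, k}) :
    E ∈ idealOf F {i, j, k} := by
  have h1 : ∀ q r, E * w11 (Dp (F i)) (Dp (F k)) q r ∈ idealOf F {i, j, k} := fun q r => by
    refine (coeff_mem_triple hF hN hij hik hjk
      (x := E * (pderiv q (F k) * pderiv r (F j) - pderiv r (F k) * pderiv q (F j)))
      (z := E * (pderiv q (F j) * pderiv r (F i) - pderiv r (F j) * pderiv q (F i)))
      fun p => ?_).2.1
    convert h p q r using 1
    simp only [w12, w11, Dp]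
    ring
  have h2 : ∀ r, E * pderiv r (F k) ∈ idealOf F {i, j, k} := fun r => by
    refine (coeff_mem_triple hF hN hij hik hjk (y := 0) (z := -(E * pderiv r (F i)))
      fun q => ?_).1
    convert h1 q r using 1
    simp only [w11, Dp]
    ring
  exact (coeff_mem_triple hF hN hij hik hjk (x := 0) (y := 0) fun r => by
    simpa using h2 r).2.2

/-- Near `F_j = 0` a form whose restrictions to `F_i = F_j = 0` and `F_j = F_k = 0` are prescribed
has an explicit shape. -/
lemma exists_normal_form [NeZero N] (hF : NormalCrossings F) (hN : 4 ≤ N) {α : Form1 N}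
    {i j k : Fin m} (hij : i ≠ j) (hik : i ≠ k) (hjk : j ≠ k) {G A A' B B' : S N}
    (h1 : ∀ l, α l - F k * G * (A * pderiv l (F i) + A' * pderiv l (F j)) ∈ idealOf F {i, j})
    (h2 : ∀ l, α l - F i * G * (B * pderiv l (F k) + B' * pderiv l (F j)) ∈ idealOf F {k, j}) :
    ∃ (μ σ : Form1 N) (κ : S N), α = fun l => G * A * (F k * pderiv l (F i)) +
      G * B * (F i * pderiv l (F k)) + F i * F k * μ l + κ * pderiv l (F j) + F j * σ l := by
  have key : ∀ l, ∃ μ σ : S N, α l = G * A * (F k * pderiv l (F i)) +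
      G * B * (F i * pderiv l (F k)) + F i * F k * μ +
      (F k * G * A' + F i * G * B') * pderiv l (F j) + F j * σ := by
    intro l
    obtain ⟨μ, hμ⟩ := exists_sub_mul_prod_mem hF (s := {j}) (T := {i, k})
      (a := α l - F k * G * (A * pderiv l (F i) + A' * pderiv l (F j)) -
        F i * G * (B * pderiv l (F k) + B' * pderiv l (F j)))
      (by rw [card_singleton]; omega) (by simp [hij.symm, hjk]) (fun t ht => by
        rw [Finset.mem_insert, Finset.mem_singleton] at ht
        rcases ht with rfl | rfl
        · exact Ideal.sub_mem _ (h1 l) (Ideal.mul_mem_right _ _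
            (Ideal.mul_mem_right _ _ (mem_idealOf (by simp))))
        · rw [sub_right_comm]
          exact Ideal.sub_mem _ (h2 l) (Ideal.mul_mem_right _ _
            (Ideal.mul_mem_right _ _ (mem_idealOf (by simp)))))
    rw [Finset.prod_pair hik, idealOf, Finset.coe_singleton, Set.image_singleton] at hμ
    obtain ⟨σ, hσ⟩ := Ideal.mem_span_singleton'.1 hμ
    exact ⟨μ, σ, by linear_combination -hσ⟩
  choose μ σ h using key
  exact ⟨μ, σ, _, funext h⟩

set_option maxHeartbeats 1000000 in
/-- The coefficients of `dF_i` and `dF_k` along `F_i = F_j = 0` and `F_k = F_j = 0` are proportional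
to `λ_i` and `λ_k` on the triple intersection. -/
lemma coeff_proportional [NeZero N] (hF : NormalCrossings F) (hN : 4 ≤ N) {lam : Fin m → ℂ} {α : Form1 N}
    (ht : TangentZero (logForm lam F) α) {i j k : Fin m} (hij : i ≠ j) (hik : i ≠ k) (hjk : j ≠ k)
    {A A' B B' : S N}
    (h1 : ∀ l, α l - Fhat2 F i j * (A * pderiv l (F i) + A' * pderiv l (F j)) ∈ idealOf F {i, j})
    (h2 : ∀ l, α l - Fhat2 F k j * (B * pderiv l (F k) + B' * pderiv l (F j)) ∈ idealOf F {k, j}) :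
    C (lam i) * B - C (lam k) * A ∈ idealOf F {i, j, k} := by
  obtain ⟨ρ, hρ⟩ := logForm_eq (F := F) lam {i, j, k}
  set G := ∏ a ∈ ({i, j, k} : Finset (Fin m))ᶜ, F a with hG
  have hω : logForm lam F = fun l => G * (C (lam i) * (F j * F k) * pderiv l (F i) +
      (C (lam j) * (F i * F k) * pderiv l (F j) + C (lam k) * (F i * F j) * pderiv l (F k))) +
      F i * (F j * F k) * ρ l := by
    funext l
    rw [hρ l, Finset.sum_insert (by simp [hij, hik]), Finset.sum_pair hjk,
      Finset.prod_insert (by simp [hij, hik]), Finset.prod_pair hjk]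
    have e1 : ({i, j, k} : Finset (Fin m)).erase i = {j, k} := by ext; simp; grind
    have e2 : ({i, j, k} : Finset (Fin m)).erase j = {i, k} := by ext; simp; grind
    have e3 : ({i, j, k} : Finset (Fin m)).erase k = {i, j} := by ext; simp; grind
    rw [e1, e2, e3, Finset.prod_pair hjk, Finset.prod_pair hik, Finset.prod_pair hij]
  have hGij : Fhat2 F i j = F k * G := by
    have : ({i, j} : Finset (Fin m))ᶜ = insert k ({i, j, k} : Finset (Fin m))ᶜ := by
      ext; simp; grind
    rw [Fhat2_eq, this, Finset.prod_insert (by simp)]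
  have hGkj : Fhat2 F k j = F i * G := by
    have : ({k, j} : Finset (Fin m))ᶜ = insert i ({i, j, k} : Finset (Fin m))ᶜ := by
      ext; simp; grind
    rw [Fhat2_eq, this, Finset.prod_insert (by simp)]
  rw [hGij] at h1
  rw [hGkj] at h2
  obtain ⟨μ, σ, κ, hα⟩ := exists_normal_form hF hN hij hik hjk h1 h2
  clear h1 h2
  let α₀ : Form1 N := fun l => G * A * (F k * pderiv l (F i)) +
    G * B * (F i * pderiv l (F k)) + F i * F k * μ l
  let ν : Form1 N := fun l => C (lam j) * pderiv l G - ρ l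
  let η : Fin N → Fin N → S N := fun p q =>
    G * A * (G * C (lam j - lam k)) * w11 (Dp (F i)) (Dp (F k)) p q +
    G * B * (G * C (lam j - lam i)) * w11 (Dp (F k)) (Dp (F i)) p q +
    G * A * F k * w11 (Dp (F i)) ν p q + G * B * F i * w11 (Dp (F k)) ν p q +
    F k * (G * C (lam j - lam i)) * w11 μ (Dp (F i)) p q +
    F i * (G * C (lam j - lam k)) * w11 μ (Dp (F k)) p q + F i * F k * w11 μ ν p q
  let W : Fin N → Fin N → Fin N → S N := fun p q r =>
    C (lam j) * G * w12 (Dp (F j)) (extD α₀) p q r + w12 (Dp (F j)) η p q r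
  have hW : ∀ p q r, W p q r ∈ idealOf F {j} := by
    intro p q r
    have hi : NZD (idealOf F {j}) (F i) :=
      nzd_idealOf hF (by rw [card_singleton]; omega) (by simpa using hij)
    have hk : NZD (idealOf F {j}) (F k) :=
      nzd_idealOf hF (by rw [card_singleton]; omega) (by simpa using hjk.symm)
    refine (hi.mul hk) _ ?_
    have hj0 : Ideal.Quotient.mk (idealOf F {j}) (F j) = 0 :=
      Ideal.Quotient.eq_zero_iff_mem.2 (mem_idealOf (by simp))
    have h0 := congrArg (Ideal.Quotient.mk (idealOf F {j})) (ht p q r)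
    rw [map_zero] at h0
    rw [← Ideal.Quotient.eq_zero_iff_mem, ← h0, hω, hα]
    simp only [W, η, ν, α₀, w12, extD, w11, Dp, map_add, map_sub, map_mul, pderiv_mul, pderiv_C,
      map_zero, hj0, pderiv_comm q p, pderiv_comm r p, pderiv_comm r q]
    ring
  have hdet : ∀ p q r, (C (lam i) * B - C (lam k) * A) *
      w12 (Dp (F j)) (w11 (Dp (F i)) (Dp (F k))) p q r ∈ idealOf F {i, j, k} := by
    intro p q r
    have hnzd : NZD (idealOf F {i, j, k}) G :=
      nzd_prod_compl hF (by rw [card_eq_three.2 ⟨i, j, k, hij, hik, hjk, rfl⟩]; omega)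
    refine (hnzd.mul hnzd) _ ?_
    have hi0 : Ideal.Quotient.mk (idealOf F {i, j, k}) (F i) = 0 :=
      Ideal.Quotient.eq_zero_iff_mem.2 (mem_idealOf (by simp))
    have hk0 : Ideal.Quotient.mk (idealOf F {i, j, k}) (F k) = 0 :=
      Ideal.Quotient.eq_zero_iff_mem.2 (mem_idealOf (by simp))
    have h0 := Ideal.Quotient.eq_zero_iff_mem.2
      (idealOf_mono (t := {i, j, k}) (by simp) (hW p q r))
    rw [← Ideal.Quotient.eq_zero_iff_mem, ← h0]
    simp only [W, η, ν, α₀, w12, extD, w11, Dp, map_add, map_sub, map_mul, pderiv_mul,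
      hi0, hk0]
    ring
  exact mem_of_mul_det_mem hF hN hij hik hjk hdet

/-- The polynomials `F'_j`, before making them homogeneous. -/
lemma exists_common_coeffs [NeZero N] (hF : NormalCrossings F) (hN : 4 ≤ N) {lam : Fin m → ℂ}
    (hlam : ∀ i j, i ≠ j → lam i ≠ lam j) (hlam0 : ∀ i, lam i ≠ 0) {α : Form1 N}
    (ht : TangentZero (logForm lam F) α) :
    ∃ f : Fin m → S N, ∀ i j, i ≠ j → ∀ l,
      α l - Fhat2 F i j * (C (lam i) * f j * pderiv l (F i) + C (lam j) * f i * pderiv l (F j)) ∈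
        idealOf F {i, j} := by
  obtain ⟨A, hA⟩ := exists_coeffs hF hN hlam ht
  have hC : ∀ i, C (lam i) * C (lam i)⁻¹ = (1 : S N) := fun i => by
    rw [← C_mul, mul_inv_cancel₀ (hlam0 i), C_1]
  have hglue : ∀ j, ∃ f : S N, ∀ i ∈ univ.erase j,
      f - C (lam i)⁻¹ * A i j ∈ idealOf F {i, j} := fun j => by
    refine exists_glue hF hN (fun i k hij hkj hik => ?_) (univ.erase j) (by simp)
    have h := coeff_proportional hF hN ht hij hik hkj.symm (hA i j hij) (hA k j hkj)
    have h' := Ideal.mul_mem_left _ (-(C (lam i)⁻¹ * C (lam k)⁻¹)) h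
    convert h' using 1
    linear_combination (-(C (lam i)⁻¹ * A i j)) * hC k + C (lam k)⁻¹ * A k j * hC i
  choose f hf using hglue
  have hf' : ∀ i j, i ≠ j → C (lam i) * f j - A i j ∈ idealOf F {i, j} := fun i j hij => by
    convert Ideal.mul_mem_left _ (C (lam i)) (hf j i (by simp [hij])) using 1
    linear_combination A i j * hC i
  refine ⟨f, fun i j hij l => ?_⟩
  have h1 := Ideal.mul_mem_left _ (Fhat2 F i j) (add_mem
    (Ideal.mul_mem_right (pderiv l (F i)) _ (hf' i j hij))
    (Ideal.mul_mem_right (pderiv l (F j)) _ (Finset.pair_comm j i ▸ hf' j i hij.symm)))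
  convert Ideal.sub_mem _ (hA i j hij l) h1 using 1
  ring

lemma homogeneousComponent_mul_of_isHomogeneous {p q : S N} {e : ℕ} (hq : q.IsHomogeneous e)
    (k : ℕ) : homogeneousComponent (k + e) (p * q) = homogeneousComponent k p * q := by
  let _ : GradedAlgebra (homogeneousSubmodule (Fin N) ℂ) := MvPolynomial.gradedAlgebra
  rw [← decomposition.decompose'_apply, ← decomposition.decompose'_apply]
  exact DirectSum.coe_decompose_mul_add_of_right_mem (homogeneousSubmodule (Fin N) ℂ) hq

lemma homogeneousComponent_mem_idealOf {dd : Fin m → ℕ} (hFh : ∀ i, (F i).IsHomogeneous (dd i))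
    {s : Finset (Fin m)} {p : S N} (hp : p ∈ idealOf F s) (k : ℕ) :
    homogeneousComponent k p ∈ idealOf F s := by
  let _ : GradedAlgebra (homogeneousSubmodule (Fin N) ℂ) := MvPolynomial.gradedAlgebra
  refine homogeneousComponent_mem_of_mem ?_ hp k
  refine Ideal.homogeneous_span _ _ ?_
  rintro _ ⟨i, -, rfl⟩
  exact ⟨dd i, hFh i⟩

lemma eval_eq_zero_of_mem_idealOf {s : Finset (Fin m)} {p : S N} (hp : p ∈ idealOf F s)
    {x : Fin N → ℂ} (hx : ∀ i ∈ s, eval x (F i) = 0) : eval x p = 0 := by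
  have : idealOf F s ≤ RingHom.ker (eval x) := by
    rw [idealOf, Ideal.span_le]
    rintro _ ⟨i, hi, rfl⟩
    exact hx i (by exact_mod_cast hi)
  exact this hp

lemma isHomogeneous_Fhat2_mul_pderiv {dd : Fin m → ℕ} (hd : ∀ i, 1 ≤ dd i)
    (hFh : ∀ i, (F i).IsHomogeneous (dd i)) {i j : Fin m} (hij : i ≠ j) (l : Fin N) :
    ∃ e, dd j + e = ∑ i, dd i - 1 ∧ (Fhat2 F i j * pderiv l (F i)).IsHomogeneous e := by
  refine ⟨_, ?_, (IsHomogeneous.prod _ _ _ fun k _ => hFh k).mul (hFh i).pderiv⟩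
  have h1 := Finset.add_sum_erase univ dd (mem_univ i)
  have h2 := Finset.add_sum_erase (univ.erase i) dd (a := j) (by simp [hij.symm])
  have := hd i
  omega

end Structure

/-- On each `X_{ij}` a tangent 1-form `α` can be written as
`α = F̂ᵢⱼ (Aᵢⱼ dFᵢ + Aⱼᵢ dFⱼ)` with `Aᵢⱼ` homogeneous of degree `dⱼ`; moreover the `A`'s
may be chosen so that `Aᵢⱼ = λᵢ F'ⱼ` on `X_{ij}` for a single homogeneous `F'ⱼ` of
degree `dⱼ`. -/
theorem statement16 (n m d : ℕ) (hn : 3 ≤ n) (dd : Fin m → ℕ) (lam : Fin m → ℂ)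
    (F : Fin m → S (n+1))
    (hd : ∀ i, 1 ≤ dd i) (hsum : ∑ i, dd i = d)
    (hFh : ∀ i, (F i).IsHomogeneous (dd i)) (hgen : GeneralPosition F)
    (hlam : ∀ i j, i ≠ j → lam i ≠ lam j) (hlam0 : ∀ i, lam i ≠ 0)
    (hlamd : ∑ i, (dd i : ℂ) * lam i = 0)
    (α : Form1 (n+1)) (hαh : IsHomog1 α d) (hαp : radial α = 0)
    (ht : TangentZero (logForm lam F) α) :
    ∃ A : Fin m → Fin m → S (n+1), ∃ F' : Fin m → S (n+1),
      (∀ i j, i ≠ j → (A i j).IsHomogeneous (dd j)) ∧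
      (∀ j, (F' j).IsHomogeneous (dd j)) ∧
      ∀ i j, i ≠ j → ∀ x : Fin (n+1) → ℂ, x ≠ 0 →
        eval x (F i) = 0 → eval x (F j) = 0 →
        (∀ l, eval x (α l) = eval x (Fhat2 F i j) *
            (eval x (A i j) * eval x (pderiv l (F i)) +
             eval x (A j i) * eval x (pderiv l (F j)))) ∧
        eval x (A i j) = lam i * eval x (F' j) := by
  obtain ⟨f, hf⟩ := exists_common_coeffs hgen.2 (by omega) hlam hlam0 ht
  refine ⟨fun i j => C (lam i) * homogeneousComponent (dd j) (f j),
    fun j => homogeneousComponent (dd j) (f j), fun i j _ => ?_,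
    fun j => homogeneousComponent_isHomogeneous _ _, fun i j hij x _ hi hj => ⟨fun l => ?_, ?_⟩⟩
  · simpa using (isHomogeneous_C (Fin (n + 1)) (lam i)).mul
      (homogeneousComponent_isHomogeneous (dd j) (f j))
  · obtain ⟨e, he, hhom⟩ := isHomogeneous_Fhat2_mul_pderiv hd hFh hij l
    obtain ⟨e', he', hhom'⟩ := isHomogeneous_Fhat2_mul_pderiv hd hFh hij.symm l
    have h1 := homogeneousComponent_mem_idealOf hFh (hf i j hij l) (d - 1)
    have h2 : Fhat2 F i j * (C (lam i) * f j * pderiv l (F i) + C (lam j) * f i * pderiv l (F j)) =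
        C (lam i) * (f j * (Fhat2 F i j * pderiv l (F i))) +
          C (lam j) * (f i * (Fhat2 F j i * pderiv l (F j))) := by
      rw [Fhat2_comm j i]
      ring
    have h3 : homogeneousComponent (d - 1) (f j * (Fhat2 F i j * pderiv l (F i))) =
        homogeneousComponent (dd j) (f j) * (Fhat2 F i j * pderiv l (F i)) := by
      rw [← hsum, ← he, homogeneousComponent_mul_of_isHomogeneous hhom]
    have h4 : homogeneousComponent (d - 1) (f i * (Fhat2 F j i * pderiv l (F j))) =
        homogeneousComponent (dd i) (f i) * (Fhat2 F j i * pderiv l (F j)) := by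
      rw [← hsum, ← he', homogeneousComponent_mul_of_isHomogeneous hhom']
    rw [h2, map_sub, map_add, homogeneousComponent_C_mul, homogeneousComponent_C_mul, h3, h4,
      homogeneousComponent_eq_self (hαh l)] at h1
    have h5 := eval_eq_zero_of_mem_idealOf h1 (x := x) (by simp [hi, hj])
    rw [Fhat2_comm j i] at h5
    simp only [map_sub, map_add, map_mul, eval_C] at h5 ⊢
    linear_combination h5
  · simp

end LogStab
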